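/- Let f be a measurable function on 𝕋. Then ∫_𝕋 M(f)(θ) log⁺(M(f)(θ)) log⁺ log⁺(M(f)(θ)) dθ < ∞ if and only if ∫_𝕋 |f(θ)| (log⁺ |f(θ)|)² log⁺ log⁺ |f(θ)| dθ < ∞. (In other words, the Hardy–Littlewood maximal function M(f) belongs to the Orlicz space defined by Φ(t) = t log⁺ t log⁺ log⁺ t if and only if f ∈ L log² L log log L(𝕋).) -/

import Mathlib

open MeasureTheory Real ENNReal

/-- `log⁺ s = max (log s) 0`. -/
noncomputable def logPlus (s : ℝ) : ℝ := max (Real.log s) 0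

/-- The Hardy–Littlewood maximal function on the torus: the supremum of averages of `|f|`
over open arcs (represented as intervals `(a,b)` of length at most `2π`) containing `θ`. -/
noncomputable def maximalT (f : ℝ → ℝ) (θ : ℝ) : ℝ≥0∞ :=
  ⨆ (a : ℝ) (b : ℝ) (_ : a < θ) (_ : θ < b) (_ : b - a ≤ 2 * π),
    (ENNReal.ofReal (b - a))⁻¹ * ∫⁻ y in Set.Ioo a b, (‖f y‖₊ : ℝ≥0∞)

/-- `Φ(t) = t log⁺ t log⁺ log⁺ t`, extended to `t = ∞` by `Φ(∞) = ∞`. -/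
noncomputable def PhiE (t : ℝ≥0∞) : ℝ≥0∞ :=
  if t = ⊤ then ⊤
  else ENNReal.ofReal (t.toReal * logPlus t.toReal * logPlus (logPlus t.toReal))

/-- An estimate on every component interval of a bounded open set integrates to an estimate on the
whole set. -/
theorem setLIntegral_le_of_forall_component {U : Set ℝ} (hU : IsOpen U) {l u : ℝ}
    (hlu : U ⊆ Set.Ioo l u) (g : ℝ → ℝ≥0∞) (c : ℝ≥0∞)
    (h : ∀ a b, a < b → Set.Ioo a b ⊆ U → a ∉ U → b ∉ U →
      ∫⁻ y in Set.Ioo a b, g y ≤ c * ENNReal.ofReal (b - a)) :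
    ∫⁻ y in U, g y ≤ c * volume U := by
  set S : Set (Set ℝ) := connectedComponentIn U '' U
  have hopen : ∀ C ∈ S, IsOpen C := by
    rintro _ ⟨x, -, rfl⟩
    exact hU.connectedComponentIn
  have hdisj : S.PairwiseDisjoint id := by
    rintro _ ⟨x, -, rfl⟩ _ ⟨y, -, rfl⟩ hne
    refine Set.disjoint_left.2 fun z hzx hzy => hne ?_
    rw [connectedComponentIn_eq hzx, connectedComponentIn_eq hzy]
  have hcount : S.Countable := by
    refine hdisj.countable_of_isOpen hopen ?_
    rintro _ ⟨x, hx, rfl⟩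
    exact ⟨x, mem_connectedComponentIn hx⟩
  have hUeq : U = ⋃ C ∈ S, C := by
    ext x
    simp only [Set.mem_iUnion, exists_prop]
    constructor
    · exact fun hx => ⟨_, ⟨x, hx, rfl⟩, mem_connectedComponentIn hx⟩
    · rintro ⟨_, ⟨y, -, rfl⟩, hx⟩
      exact connectedComponentIn_subset _ _ hx
  have hcomp : ∀ C ∈ S, ∫⁻ y in C, g y ≤ c * volume C := by
    rintro _ ⟨x, hx, rfl⟩
    set C := connectedComponentIn U x
    have hCU : C ⊆ U := connectedComponentIn_subset _ _
    have hxC : x ∈ C := mem_connectedComponentIn hx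
    have hCo : IsOpen C := hU.connectedComponentIn
    have hpre : IsPreconnected C := isPreconnected_connectedComponentIn
    have hba : BddAbove C := ⟨u, fun y hy => (hlu (hCU hy)).2.le⟩
    have hbb : BddBelow C := ⟨l, fun y hy => (hlu (hCU hy)).1.le⟩
    have hsub : Set.Ioo (sInf C) (sSup C) ⊆ C :=
      IsConnected.Ioo_csInf_csSup_subset ⟨⟨x, hxC⟩, hpre⟩ hbb hba
    have hinf : sInf C ∉ C := by
      intro hm
      obtain ⟨ε, hε, hball⟩ := Metric.isOpen_iff.1 hCo _ hm
      have : sInf C - ε / 2 ∈ C := hball (by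
        rw [Metric.mem_ball, Real.dist_eq, abs_lt]; constructor <;> linarith)
      linarith [csInf_le hbb this]
    have hsup : sSup C ∉ C := by
      intro hm
      obtain ⟨ε, hε, hball⟩ := Metric.isOpen_iff.1 hCo _ hm
      have : sSup C + ε / 2 ∈ C := hball (by
        rw [Metric.mem_ball, Real.dist_eq, abs_lt]; constructor <;> linarith)
      linarith [le_csSup hba this]
    have hIoo : C = Set.Ioo (sInf C) (sSup C) := by
      refine Set.Subset.antisymm (fun y hy => ⟨?_, ?_⟩) hsub
      · exact lt_of_le_of_ne (csInf_le hbb hy) fun e => hinf (e ▸ hy)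
      · exact lt_of_le_of_ne (le_csSup hba hy) fun e => hsup (e ▸ hy)
    have hx' : x ∈ Set.Ioo (sInf C) (sSup C) := hIoo ▸ hxC
    have hinfU : sInf C ∉ U := by
      intro hm
      have hs : Set.Ico (sInf C) (sSup C) ⊆ U := by
        intro y hy
        rcases eq_or_lt_of_le hy.1 with e | e
        · exact e ▸ hm
        · exact hCU (hsub ⟨e, hy.2⟩)
      exact hinf (isPreconnected_Ico.subset_connectedComponentIn ⟨hx'.1.le, hx'.2⟩ hs
        ⟨le_rfl, hx'.1.trans hx'.2⟩)
    have hsupU : sSup C ∉ U := by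
      intro hm
      have hs : Set.Ioc (sInf C) (sSup C) ⊆ U := by
        intro y hy
        rcases eq_or_lt_of_le hy.2 with e | e
        · exact e ▸ hm
        · exact hCU (hsub ⟨hy.1, e⟩)
      exact hsup (isPreconnected_Ioc.subset_connectedComponentIn ⟨hx'.1, hx'.2.le⟩ hs
        ⟨hx'.1.trans hx'.2, le_rfl⟩)
    have := h _ _ (hx'.1.trans hx'.2) (hsub.trans hCU) hinfU hsupU
    rw [hIoo, Real.volume_Ioo]
    exact this
  calc ∫⁻ y in U, g y = ∑' C : S, ∫⁻ y in (C : Set ℝ), g y := by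
        conv_lhs => rw [hUeq]
        exact lintegral_biUnion hcount (fun C hC => (hopen C hC).measurableSet) hdisj g
    _ ≤ ∑' C : S, c * volume (C : Set ℝ) := ENNReal.tsum_le_tsum fun C => hcomp C C.2
    _ = c * volume U := by
        rw [ENNReal.tsum_mul_left]
        conv_rhs => rw [hUeq]
        exact congrArg (c * ·)
          (measure_biUnion hcount hdisj fun C hC => (hopen C hC).measurableSet).symm

theorem le_maximalT (f : ℝ → ℝ) {a b θ : ℝ} (ha : a < θ) (hb : θ < b) (hab : b - a ≤ 2 * π) :
    (ENNReal.ofReal (b - a))⁻¹ * ∫⁻ y in Set.Ioo a b, ‖f y‖ₑ ≤ maximalT f θ :=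
  le_iSup_of_le a <| le_iSup_of_le b <| le_iSup_of_le ha <| le_iSup_of_le hb <|
    le_iSup_of_le hab le_rfl

theorem lt_maximalT_iff {f : ℝ → ℝ} {θ : ℝ} {t : ℝ≥0∞} :
    t < maximalT f θ ↔ ∃ a b, a < θ ∧ θ < b ∧ b - a ≤ 2 * π ∧
      t * ENNReal.ofReal (b - a) < ∫⁻ y in Set.Ioo a b, ‖f y‖ₑ := by
  have key : ∀ {a b : ℝ}, a < b → (t < (ENNReal.ofReal (b - a))⁻¹ *
      ∫⁻ y in Set.Ioo a b, ‖f y‖ₑ ↔ t * ENNReal.ofReal (b - a) < ∫⁻ y in Set.Ioo a b, ‖f y‖ₑ) := by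
    intro a b hab
    rw [mul_comm (ENNReal.ofReal (b - a))⁻¹, ← div_eq_mul_inv]
    exact ENNReal.lt_div_iff_mul_lt (Or.inl (by simpa using hab)) (Or.inl ENNReal.ofReal_ne_top)
  simp only [maximalT, lt_iSup_iff, exists_prop]
  refine exists_congr fun a => exists_congr fun b => ?_
  constructor
  · rintro ⟨h1, h2, h3, h4⟩
    exact ⟨h1, h2, h3, (key (h1.trans h2)).1 h4⟩
  · rintro ⟨h1, h2, h3, h4⟩
    exact ⟨h1, h2, h3, (key (h1.trans h2)).2 h4⟩

theorem isOpen_lt_maximalT (f : ℝ → ℝ) (t : ℝ≥0∞) : IsOpen {θ | t < maximalT f θ} := by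
  simp only [lt_maximalT_iff]
  refine isOpen_iff_mem_nhds.2 ?_
  rintro θ ⟨a, b, h1, h2, h3, h4⟩
  filter_upwards [Ioo_mem_nhds h1 h2] with x hx
  exact ⟨a, b, hx.1, hx.2, h3, h4⟩

theorem measurable_maximalT (f : ℝ → ℝ) : Measurable (maximalT f) :=
  measurable_of_Ioi fun t => (isOpen_lt_maximalT f t).measurableSet

/-- The Lebesgue differentiation theorem: `|f| ≤ M f` almost everywhere. -/
theorem ae_enorm_le_maximalT {f : ℝ → ℝ} (hf : Measurable f)
    (hfin : ∫⁻ y in Set.Ioo 0 (2 * π), ‖f y‖ₑ ≠ ∞) :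
    ∀ᵐ x ∂volume.restrict (Set.Ioo 0 (2 * π)), ‖f x‖ₑ ≤ maximalT f x := by
  rw [ae_restrict_iff' measurableSet_Ioo]
  have hI : MeasurableSet (Set.Ioo 0 (2 * π)) := measurableSet_Ioo
  have h := (Besicovitch.vitaliFamily (volume : Measure ℝ)).ae_tendsto_lintegral_div'
    (f := (Set.Ioo 0 (2 * π)).indicator fun y => ‖f y‖ₑ) (hf.enorm.indicator hI)
    (by rwa [lintegral_indicator hI])
  filter_upwards [h] with x hx hxI
  have hx' := hx.comp (Besicovitch.tendsto_filterAt volume x)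
  rw [Set.indicator_of_mem hxI] at hx'
  refine le_of_tendsto hx' ?_
  filter_upwards [Ioo_mem_nhdsGT Real.pi_pos] with r hr
  have hr0 := hr.1
  have hrπ := hr.2
  refine le_trans ?_ (le_maximalT f (a := x - r) (b := x + r) (by linarith) (by linarith)
    (by linarith))
  simp only [Function.comp_apply]
  rw [Real.volume_closedBall, div_eq_mul_inv, mul_comm, Real.closedBall_eq_Icc,
    setLIntegral_congr Ioo_ae_eq_Icc.symm, show x + r - (x - r) = 2 * r by ring]
  gcongr
  exact Set.indicator_le_self _ _ _

/-- The reverse weak-type inequality. -/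
theorem setLIntegral_le_mul_measure_lt_maximalT {f : ℝ → ℝ} (hf : Measurable f) {t : ℝ≥0∞}
    (ht : t ≠ ∞) (hmean : ∫⁻ y in Set.Ioo 0 (2 * π), ‖f y‖ₑ ≤ t * ENNReal.ofReal (2 * π)) :
    ∫⁻ y in Set.Ioo 0 (2 * π), {y | t < ‖f y‖ₑ}.indicator (fun y => ‖f y‖ₑ) y ≤
      t * volume.restrict (Set.Ioo 0 (2 * π)) {θ | t < maximalT f θ} := by
  set E := {θ | t < maximalT f θ}
  have hEo : IsOpen E := isOpen_lt_maximalT f t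
  have hfin : ∫⁻ y in Set.Ioo 0 (2 * π), ‖f y‖ₑ ≠ ∞ :=
    (hmean.trans_lt (ENNReal.mul_lt_top ht.lt_top ENNReal.ofReal_lt_top)).ne
  have hstep : ∫⁻ y in Set.Ioo 0 (2 * π), {y | t < ‖f y‖ₑ}.indicator (fun y => ‖f y‖ₑ) y ≤
      ∫⁻ y in E ∩ Set.Ioo 0 (2 * π), ‖f y‖ₑ := by
    rw [← Measure.restrict_restrict hEo.measurableSet, ← lintegral_indicator hEo.measurableSet]
    refine lintegral_mono_ae ?_
    filter_upwards [ae_enorm_le_maximalT hf hfin] with x hx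
    by_cases hxt : t < ‖f x‖ₑ
    · rw [Set.indicator_of_mem (show x ∈ {y | t < ‖f y‖ₑ} from hxt),
        Set.indicator_of_mem (show x ∈ E from hxt.trans_le hx)]
    · rw [Set.indicator_of_notMem (show x ∉ {y | t < ‖f y‖ₑ} from hxt)]
      exact zero_le
  refine hstep.trans ?_
  rw [Measure.restrict_apply hEo.measurableSet]
  refine setLIntegral_le_of_forall_component (hEo.inter isOpen_Ioo) Set.inter_subset_right _ _ ?_
  intro a b hab hsub ha hb
  have hsub' : Set.Ioo a b ⊆ Set.Ioo 0 (2 * π) := hsub.trans Set.inter_subset_right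
  obtain ⟨ha0, hb2⟩ := (Set.Ioo_subset_Ioo_iff hab).1 hsub'
  have hlim : ∀ {x : ℝ≥0∞}, (∀ ε : ℝ, 0 < ε → ε ≤ 2 * π - (b - a) →
      x ≤ t * ENNReal.ofReal (b - a + ε)) → 0 < 2 * π - (b - a) →
      x ≤ t * ENNReal.ofReal (b - a) := by
    intro x hx hpos
    have hc : Filter.Tendsto (fun ε : ℝ => t * ENNReal.ofReal (b - a + ε))
        (nhdsWithin 0 (Set.Ioi 0)) (nhds (t * ENNReal.ofReal (b - a + 0))) := by
      refine ENNReal.Tendsto.const_mul ?_ (Or.inr ht)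
      exact (ENNReal.continuous_ofReal.comp
        (continuous_const.add continuous_id)).continuousAt.tendsto.mono_left nhdsWithin_le_nhds
    rw [add_zero] at hc
    refine ge_of_tendsto hc ?_
    filter_upwards [Ioo_mem_nhdsGT hpos] with ε hε
    exact hx ε hε.1 hε.2.le
  have harc : ∀ {θ a' b' : ℝ}, θ ∉ E → a' < θ → θ < b' → b' - a' ≤ 2 * π →
      ∫⁻ y in Set.Ioo a' b', ‖f y‖ₑ ≤ t * ENNReal.ofReal (b' - a') := by
    intro θ a' b' hθ h1 h2 h3
    by_contra! hcon
    exact hθ (lt_maximalT_iff.2 ⟨a', b', h1, h2, h3, hcon⟩)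
  rcases eq_or_lt_of_le (show b - a ≤ 2 * π by linarith) with heq | hlt
  · have h1 : a = 0 := by linarith
    have h2 : b = 2 * π := by linarith
    rw [h1, h2, sub_zero]
    exact hmean
  · by_cases haE : a ∈ E
    · have ha' : a = 0 := by
        by_contra hne
        exact ha ⟨haE, lt_of_le_of_ne ha0 (Ne.symm hne), by linarith⟩
      have hbE : b ∉ E := fun hm => hb ⟨hm, by linarith, by linarith⟩
      refine hlim (fun ε hε hε' => ?_) (by linarith)
      have := harc (a' := a) (b' := b + ε) hbE hab (by linarith) (by linarith)
      rw [show b - a + ε = b + ε - a by ring]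
      exact (lintegral_mono_set (Set.Ioo_subset_Ioo le_rfl (by linarith))).trans this
    · refine hlim (fun ε hε hε' => ?_) (by linarith)
      have := harc (a' := a - ε) (b' := b) haE (by linarith) hab (by linarith)
      rw [show b - a + ε = b - (a - ε) by ring]
      exact (lintegral_mono_set (Set.Ioo_subset_Ioo (by linarith) le_rfl)).trans this

theorem setLIntegral_Ico_periodic_le {g : ℝ → ℝ≥0∞} (hg : Function.Periodic g (2 * π)) :
    ∫⁻ y in Set.Ioo (-(2 * π)) (4 * π), g y ≤ 3 * ∫⁻ y in Set.Ico 0 (2 * π), g y := by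
  have hπ := Real.pi_pos
  have hshift : ∀ c : ℝ, (∀ y, g (y + c) = g y) → ∫⁻ y in Set.Ico c (2 * π + c), g y =
      ∫⁻ y in Set.Ico 0 (2 * π), g y := by
    intro c hc
    have := (measurePreserving_add_right (volume : Measure ℝ) c).setLIntegral_comp_preimage_emb
      (MeasurableEquiv.addRight c).measurableEmbedding g (Set.Ico c (2 * π + c))
    rw [← this]
    simp [hc]
  have h1 := hshift (2 * π) hg
  have h2 := hshift (-(2 * π)) fun y => by rw [← hg (y + -(2 * π))]; congr 1; ring
  calc ∫⁻ y in Set.Ioo (-(2 * π)) (4 * π), g y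
      ≤ ∫⁻ y in (Set.Ico (-(2 * π)) (2 * π + -(2 * π)) ∪ Set.Ico 0 (2 * π)) ∪
          Set.Ico (2 * π) (2 * π + 2 * π), g y := by
        refine lintegral_mono_set fun y hy => ?_
        simp only [Set.mem_union, Set.mem_Ico]
        rcases lt_or_ge y 0 with h | h
        · exact Or.inl (Or.inl ⟨hy.1.le, by linarith⟩)
        · rcases lt_or_ge y (2 * π) with h' | h'
          · exact Or.inl (Or.inr ⟨h, h'⟩)
          · exact Or.inr ⟨h', by linarith [hy.2]⟩
    _ ≤ ((∫⁻ y in Set.Ico (-(2 * π)) (2 * π + -(2 * π)), g y) + ∫⁻ y in Set.Ico 0 (2 * π), g y) +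
          ∫⁻ y in Set.Ico (2 * π) (2 * π + 2 * π), g y :=
        (lintegral_union_le _ _ _).trans (add_le_add_left (lintegral_union_le _ _ _) _)
    _ = 3 * ∫⁻ y in Set.Ico 0 (2 * π), g y := by rw [h1, h2]; ring

/-- The weak-type inequality, localised to the large values of `f`. -/
theorem mul_measure_lt_maximalT_le {f : ℝ → ℝ}
    (hper : Function.Periodic f (2 * π)) {t : ℝ≥0∞} (ht : t ≠ ∞) :
    t * volume.restrict (Set.Ico 0 (2 * π)) {θ | t < maximalT f θ} ≤
      30 * ∫⁻ y in Set.Ico 0 (2 * π), {y | t / 2 < ‖f y‖ₑ}.indicator (fun y => ‖f y‖ₑ) y := by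
  set E := {θ | t < maximalT f θ}
  set g : ℝ → ℝ≥0∞ := {y | t / 2 < ‖f y‖ₑ}.indicator (fun y => ‖f y‖ₑ) with hg
  have hgper : Function.Periodic g (2 * π) := by
    intro y
    by_cases h : t / 2 < ‖f y‖ₑ <;> simp [hg, hper y, h]
  set J : Set (ℝ × ℝ) := {p | p.1 < p.2 ∧ p.2 - p.1 ≤ 2 * π ∧
    Set.Ioo p.1 p.2 ⊆ Set.Ioo (-(2 * π)) (4 * π) ∧
    t * ENNReal.ofReal (p.2 - p.1) ≤ 2 * ∫⁻ y in Set.Ioo p.1 p.2, g y}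
  obtain ⟨u, huJ, hdisj, hcov⟩ := Vitali.exists_disjoint_subfamily_covering_enlargement_closedBall
    J (fun p => (p.1 + p.2) / 2) (fun p => (p.2 - p.1) / 2) π
    (fun p hp => by have := hp.2.1; linarith) 5 (by norm_num)
  have hball : ∀ p : ℝ × ℝ, Set.Ioo p.1 p.2 ⊆
      Metric.closedBall ((p.1 + p.2) / 2) ((p.2 - p.1) / 2) := by
    intro p y hy
    rw [Real.closedBall_eq_Icc]
    exact ⟨by linarith [hy.1], by linarith [hy.2]⟩
  have hdisj' : u.PairwiseDisjoint fun p => Set.Ioo p.1 p.2 :=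
    hdisj.mono fun p => hball p
  have hucount : u.Countable := hdisj'.countable_of_isOpen (fun _ _ => isOpen_Ioo)
    fun p hp => Set.nonempty_Ioo.2 (huJ hp).1
  have hsubset : E ∩ Set.Ico 0 (2 * π) ⊆
      ⋃ p ∈ u, Metric.closedBall ((p.1 + p.2) / 2) (5 * ((p.2 - p.1) / 2)) := by
    rintro θ ⟨hθ, hθI⟩
    obtain ⟨a, b, h1, h2, h3, h4⟩ := lt_maximalT_iff.1 hθ
    have hmem : (a, b) ∈ J := by
      refine ⟨h1.trans h2, h3, Set.Ioo_subset_Ioo (by linarith [hθI.1]) (by linarith [hθI.2]), ?_⟩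
      have hle : ∫⁻ y in Set.Ioo a b, ‖f y‖ₑ ≤
          (∫⁻ y in Set.Ioo a b, g y) + t / 2 * ENNReal.ofReal (b - a) := by
        rw [← Real.volume_Ioo, ← setLIntegral_const, ← lintegral_add_right _ measurable_const]
        refine lintegral_mono fun y => ?_
        by_cases hy : t / 2 < ‖f y‖ₑ
        · simp [hg, hy]
        · simpa [hg, Set.indicator, hy] using not_lt.1 hy
      have hsplit : t * ENNReal.ofReal (b - a) =
          t / 2 * ENNReal.ofReal (b - a) + t / 2 * ENNReal.ofReal (b - a) := by
        rw [← add_mul, ENNReal.add_halves]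
      have hh : t / 2 * ENNReal.ofReal (b - a) ≤ ∫⁻ y in Set.Ioo a b, g y := by
        have := h4.le.trans hle
        rw [hsplit] at this
        refine (ENNReal.add_le_add_iff_right ?_).1 this
        exact (ENNReal.mul_lt_top (ENNReal.div_lt_top ht (by norm_num)) ENNReal.ofReal_lt_top).ne
      rw [hsplit, ← two_mul]
      gcongr
    obtain ⟨p, hp, hsub⟩ := hcov _ hmem
    exact Set.mem_iUnion₂.2 ⟨p, hp, hsub (hball (a, b) ⟨h1, h2⟩)⟩
  have hmeas : volume (E ∩ Set.Ico 0 (2 * π)) ≤ ∑' p : u, 5 * ENNReal.ofReal (p.1.2 - p.1.1) := by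
    refine (measure_mono hsubset).trans ((measure_biUnion_le _ hucount _).trans ?_)
    refine ENNReal.tsum_le_tsum fun p => ?_
    rw [Real.volume_closedBall, ← ENNReal.ofReal_ofNat 5, ← ENNReal.ofReal_mul (by norm_num)]
    exact ENNReal.ofReal_le_ofReal (by linarith)
  rw [Measure.restrict_apply (isOpen_lt_maximalT f t).measurableSet]
  calc t * volume (E ∩ Set.Ico 0 (2 * π))
      ≤ t * ∑' p : u, 5 * ENNReal.ofReal (p.1.2 - p.1.1) := by gcongr
    _ = ∑' p : u, 5 * (t * ENNReal.ofReal (p.1.2 - p.1.1)) := by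
        rw [← ENNReal.tsum_mul_left]
        exact tsum_congr fun p => by ring
    _ ≤ ∑' p : u, 5 * (2 * ∫⁻ y in Set.Ioo p.1.1 p.1.2, g y) := by
        refine ENNReal.tsum_le_tsum fun p => ?_
        have := (huJ p.2).2.2.2
        gcongr
    _ = 10 * ∫⁻ y in ⋃ p ∈ u, Set.Ioo p.1 p.2, g y := by
        rw [lintegral_biUnion hucount (fun _ _ => measurableSet_Ioo) hdisj',
          ← ENNReal.tsum_mul_left]
        exact tsum_congr fun p => by ring
    _ ≤ 10 * ∫⁻ y in Set.Ioo (-(2 * π)) (4 * π), g y := by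
        gcongr
        exact Set.iUnion₂_subset fun p hp => (huJ hp).2.2.1
    _ ≤ 10 * (3 * ∫⁻ y in Set.Ico 0 (2 * π), g y) := by
        gcongr
        exact setLIntegral_Ico_periodic_le hgper
    _ = 30 * ∫⁻ y in Set.Ico 0 (2 * π), g y := by ring

theorem logPlus_nonneg (s : ℝ) : 0 ≤ logPlus s := le_max_right _ _

theorem logPlus_mono {s t : ℝ} (hs : 0 ≤ s) (hst : s ≤ t) : logPlus s ≤ logPlus t := by
  rcases hs.eq_or_lt with rfl | h
  · simp [logPlus]
  · exact max_le_max (Real.log_le_log h hst) le_rfl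

theorem logPlus_of_one_le {s : ℝ} (hs : 1 ≤ s) : logPlus s = Real.log s :=
  max_eq_left (Real.log_nonneg hs)

theorem logPlus_natCast (n : ℕ) : logPlus n = Real.log n :=
  max_eq_left (Real.log_natCast_nonneg n)

theorem logPlus_logPlus_le {t : ℝ} {n : ℕ} (h : Real.log t ≤ n) :
    logPlus t ≤ n ∧ logPlus (logPlus t) ≤ Real.log n := by
  have : logPlus t ≤ n := max_le h n.cast_nonneg
  exact ⟨this, (logPlus_mono (logPlus_nonneg t) this).trans_eq (logPlus_natCast n)⟩

theorem one_le_log_of_three_le {x : ℝ} (hx : 3 ≤ x) : 1 ≤ Real.log x := by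
  rw [Real.le_log_iff_exp_le (by linarith)]
  linarith [Real.exp_one_lt_d9]

theorem PhiE_le_tsum_indicator (x : ℝ≥0∞) :
    PhiE x ≤ ∑' k : ℕ, {z | ENNReal.ofReal (Real.exp k) < z}.indicator
      (fun _ => ENNReal.ofReal (Real.exp (k + 1) * ((k + 1) * Real.log (k + 1) + 1))) x := by
  by_cases hx : x = ∞
  · subst hx
    have : (∞ : ℝ≥0∞) = ∑' _ : ℕ, 1 := by simp
    refine le_top.trans (this.le.trans (ENNReal.tsum_le_tsum fun k => ?_))
    rw [Set.indicator_of_mem (by simp), ENNReal.one_le_ofReal]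
    have h1 : 0 ≤ Real.log ((k : ℝ) + 1) := Real.log_nonneg (by linarith [k.cast_nonneg (α := ℝ)])
    have h2 : 1 ≤ Real.exp ((k : ℝ) + 1) := Real.one_le_exp (by positivity)
    have h3 : 0 ≤ ((k : ℝ) + 1) * Real.log (k + 1) := by positivity
    nlinarith
  · rw [PhiE, if_neg hx]
    set r := x.toReal
    rcases le_or_gt r 1 with h1 | h1
    · have : logPlus r = 0 := max_eq_right (Real.log_nonpos ENNReal.toReal_nonneg h1)
      simp [this]
    · have hL : 0 < Real.log r := Real.log_pos h1
      obtain ⟨k, hk⟩ := Nat.exists_eq_succ_of_ne_zero (Nat.ceil_pos.2 hL).ne'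
      have hk1 : Real.log r ≤ ((k + 1 : ℕ) : ℝ) := by
        have := Nat.le_ceil (Real.log r)
        rwa [hk] at this
      have hk2 : (k : ℝ) < Real.log r := Nat.lt_ceil.1 (by omega)
      refine le_trans ?_ (ENNReal.le_tsum k)
      rw [Set.indicator_of_mem]
      · obtain ⟨h2, h3⟩ := logPlus_logPlus_le hk1
        refine ENNReal.ofReal_le_ofReal ?_
        push_cast at hk1 h2 h3
        have hrk : r ≤ Real.exp (k + 1) := (Real.log_le_iff_le_exp (by linarith)).1 hk1
        have := logPlus_nonneg r
        have := logPlus_nonneg (logPlus r)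
        calc r * logPlus r * logPlus (logPlus r)
            ≤ Real.exp (k + 1) * (k + 1) * Real.log (k + 1) := by gcongr
          _ ≤ Real.exp (k + 1) * ((k + 1) * Real.log (k + 1) + 1) := by
            nlinarith [Real.exp_pos ((k : ℝ) + 1)]
      · change _ < x
        rw [ENNReal.ofReal_lt_iff_lt_toReal (Real.exp_pos _).le hx]
        exact (Real.lt_log_iff_exp_lt (by linarith)).1 hk2

theorem sum_range_exp_le {N : ℕ} {L : ℝ} (h : (N : ℝ) < L + 1) :
    ∑ k ∈ Finset.range N, Real.exp k ≤ 2 * Real.exp L := by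
  induction N generalizing L with
  | zero => simpa using (Real.exp_pos L).le
  | succ n ih =>
    push_cast at h
    have h1 := ih (L := L - 1) (by linarith)
    have h2 : Real.exp n ≤ Real.exp L := Real.exp_le_exp.2 (by linarith)
    have h3 : 2 * Real.exp (L - 1) ≤ Real.exp L := by
      have : Real.exp L = Real.exp (L - 1) * Real.exp 1 := by rw [← Real.exp_add]; ring_nf
      nlinarith [Real.exp_pos (L - 1), Real.add_one_le_exp (1 : ℝ)]
    rw [Finset.sum_range_succ]
    linarith

theorem tsum_indicator_le_PhiE (x : ℝ≥0∞) :
    ∑' k : ℕ, {z | ENNReal.ofReal (Real.exp k) < z}.indicator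
      (fun _ => ENNReal.ofReal (k * Real.log k * Real.exp k)) x ≤ 2 * PhiE x := by
  by_cases hx : x = ∞
  · simp [PhiE, hx]
  set r := x.toReal
  have hmem : ∀ k : ℕ, ENNReal.ofReal (Real.exp k) < x → 0 < r ∧ (k : ℝ) < Real.log r := by
    intro k hk
    rw [ENNReal.ofReal_lt_iff_lt_toReal (Real.exp_pos _).le hx] at hk
    have h0 : 0 < r := (Real.exp_pos _).trans hk
    exact ⟨h0, (Real.lt_log_iff_exp_lt h0).2 hk⟩
  have hP0 := logPlus_nonneg r
  have hQ0 := logPlus_nonneg (logPlus r)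
  rw [tsum_eq_sum (s := Finset.range ⌈Real.log r⌉₊)]
  · rcases Nat.eq_zero_or_pos ⌈Real.log r⌉₊ with h0 | hpos
    · simp [h0]
    have hL : 0 < Real.log r := Nat.ceil_pos.1 hpos
    have hr0 : 0 < r := by
      refine lt_of_le_of_ne ENNReal.toReal_nonneg fun e => ?_
      rw [← e] at hL
      simp at hL
    calc ∑ k ∈ Finset.range ⌈Real.log r⌉₊, {z | ENNReal.ofReal (Real.exp k) < z}.indicator
          (fun _ => ENNReal.ofReal (k * Real.log k * Real.exp k)) x
        ≤ ∑ k ∈ Finset.range ⌈Real.log r⌉₊,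
            ENNReal.ofReal (logPlus r * logPlus (logPlus r) * Real.exp k) := by
          refine Finset.sum_le_sum fun k hk => (Set.indicator_le_self _ _ _).trans ?_
          have hk' : (k : ℝ) < Real.log r := Nat.lt_ceil.1 (Finset.mem_range.1 hk)
          have h1 : (k : ℝ) ≤ logPlus r := hk'.le.trans (le_max_left _ _)
          have h2 : Real.log k ≤ logPlus (logPlus r) := by
            rw [← logPlus_natCast]
            exact logPlus_mono k.cast_nonneg h1
          gcongr
      _ = ENNReal.ofReal (logPlus r * logPlus (logPlus r) *
            ∑ k ∈ Finset.range ⌈Real.log r⌉₊, Real.exp k) := by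
          rw [← ENNReal.ofReal_sum_of_nonneg (fun k _ => by positivity), Finset.mul_sum]
      _ ≤ ENNReal.ofReal (logPlus r * logPlus (logPlus r) * (2 * r)) := by
          have := sum_range_exp_le (Nat.ceil_lt_add_one hL.le)
          rw [Real.exp_log hr0] at this
          gcongr
      _ = 2 * PhiE x := by
          rw [PhiE, if_neg hx, ← ENNReal.ofReal_ofNat 2, ← ENNReal.ofReal_mul (by norm_num)]
          congr 1
          ring
  · intro k hk
    refine Set.indicator_of_notMem (fun hm => hk ?_) _
    exact Finset.mem_range.2 (Nat.lt_ceil.2 (hmem k hm).2)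

theorem nat_mul_log_le {N : ℕ} {L : ℝ} (hN : (N : ℝ) ≤ L + 2) :
    N * (N * Real.log N + 1) ≤ 130 + 10 * (max L 0 ^ 2 * logPlus (max L 0)) := by
  have hN0 : (0 : ℝ) ≤ N := N.cast_nonneg
  rcases lt_or_ge L 3 with h | h
  · have h5 : (N : ℝ) ≤ 5 := by linarith
    have hlog : Real.log N ≤ 5 := (Real.log_le_self hN0).trans h5
    have : (N : ℝ) * (N * Real.log N + 1) ≤ 5 * (5 * 5 + 1) := by
      have := Real.log_natCast_nonneg N
      gcongr
    have := logPlus_nonneg (max L 0)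
    have : 0 ≤ max L 0 ^ 2 * logPlus (max L 0) := by positivity
    linarith
  · rw [max_eq_left (by linarith), logPlus_of_one_le (by linarith)]
    have hlogL := one_le_log_of_three_le h
    have h2 : (N : ℝ) ≤ 2 * L := by linarith
    have hlog : Real.log N ≤ 2 * Real.log L := by
      rcases hN0.eq_or_lt with e | e
      · rw [← e, Real.log_zero]; linarith
      · refine (Real.log_le_log e h2).trans ?_
        rw [Real.log_mul (by norm_num) (by linarith)]
        linarith [Real.log_two_lt_d9]
    have : (N : ℝ) * (N * Real.log N + 1) ≤ 2 * L * (2 * L * (2 * Real.log L) + 1) := by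
      have := Real.log_natCast_nonneg N
      gcongr
    nlinarith [mul_nonneg (by linarith : 0 ≤ L) (by linarith : 0 ≤ Real.log L - 1),
      mul_nonneg (mul_nonneg (by linarith : 0 ≤ L) (by linarith : 0 ≤ L - 1))
        (by linarith : 0 ≤ Real.log L)]

theorem le_exp_three_add {y : ℝ} (hy : 0 ≤ y) :
    y ≤ Real.exp 3 + y * logPlus y ^ 2 * logPlus (logPlus y) := by
  have := logPlus_nonneg (logPlus y)
  rcases le_or_gt y (Real.exp 3) with h | h
  · have : 0 ≤ y * logPlus y ^ 2 * logPlus (logPlus y) := by positivity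
    linarith
  · have hL : 3 ≤ logPlus y :=
      ((Real.le_log_iff_exp_le ((Real.exp_pos 3).trans h)).2 h.le).trans (le_max_left _ _)
    have hLL : 1 ≤ logPlus (logPlus y) := (one_le_log_of_three_le hL).trans (le_max_left _ _)
    have h1 : 1 ≤ logPlus y ^ 2 := one_le_pow₀ (by linarith)
    have : y * 1 * 1 ≤ y * logPlus y ^ 2 * logPlus (logPlus y) := by gcongr
    linarith [Real.exp_pos 3]

theorem tsum_indicator_half_le {y : ℝ} (hy : 0 ≤ y) :
    ∑' k : ℕ, ENNReal.ofReal ((k + 1) * Real.log (k + 1) + 1) *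
      {z | ENNReal.ofReal (Real.exp k) / 2 < z}.indicator (fun z => z) (ENNReal.ofReal y) ≤
    ENNReal.ofReal (130 * Real.exp 3 + 140 * (y * logPlus y ^ 2 * logPlus (logPlus y))) := by
  set N := ⌊Real.log y + 2⌋₊
  rw [tsum_eq_sum (s := Finset.range N)]
  · rcases Nat.eq_zero_or_pos N with h0 | hpos
    · simp [h0]
    have hNL : (N : ℝ) ≤ Real.log y + 2 :=
      (Nat.le_floor_iff' hpos.ne').1 le_rfl
    calc ∑ k ∈ Finset.range N, ENNReal.ofReal ((k + 1) * Real.log (k + 1) + 1) *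
          {z | ENNReal.ofReal (Real.exp k) / 2 < z}.indicator (fun z => z) (ENNReal.ofReal y)
        ≤ ∑ k ∈ Finset.range N, ENNReal.ofReal (N * Real.log N + 1) * ENNReal.ofReal y := by
          refine Finset.sum_le_sum fun k hk => mul_le_mul' ?_ (Set.indicator_le_self _ _ _)
          have hk' : (k : ℝ) + 1 ≤ N := by exact_mod_cast Finset.mem_range.1 hk
          have : 0 ≤ Real.log ((k : ℝ) + 1) := by exact_mod_cast Real.log_natCast_nonneg (k + 1)
          gcongr
      _ = ENNReal.ofReal (y * (N * (N * Real.log N + 1))) := by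
          have : 0 ≤ Real.log N := Real.log_natCast_nonneg N
          rw [Finset.sum_const, Finset.card_range, nsmul_eq_mul, ← ENNReal.ofReal_natCast,
            ← ENNReal.ofReal_mul (by positivity), ← ENNReal.ofReal_mul (by positivity)]
          congr 1
          ring
      _ ≤ _ := by
          refine ENNReal.ofReal_le_ofReal ?_
          have h1 := mul_le_mul_of_nonneg_left (nat_mul_log_le hNL) hy
          have h2 := le_exp_three_add hy
          change _ ≤ y * (130 + 10 * (logPlus y ^ 2 * logPlus (logPlus y))) at h1
          linarith
  · intro k hk
    rw [Set.indicator_of_notMem, mul_zero]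
    intro hm
    refine hk (Finset.mem_range.2 ?_)
    have hm' : Real.exp k / 2 < y := by
      have : ENNReal.ofReal (Real.exp k) / 2 < ENNReal.ofReal y := hm
      rw [← ENNReal.ofReal_ofNat 2, ← ENNReal.ofReal_div_of_pos (by norm_num)] at this
      exact (ENNReal.ofReal_lt_ofReal_iff_of_nonneg (by positivity)).1 this
    have hlt : Real.exp ((k : ℝ) - 1) < y := by
      have h3 : Real.exp (k : ℝ) = Real.exp ((k : ℝ) - 1) * Real.exp 1 := by
        rw [← Real.exp_add]; ring_nf
      nlinarith [Real.exp_pos ((k : ℝ) - 1), Real.add_one_le_exp (1 : ℝ)]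
    have hlog : (k : ℝ) - 1 < Real.log y :=
      (Real.lt_log_iff_exp_lt ((Real.exp_pos _).trans hlt)).2 hlt
    exact (Nat.le_floor (by push_cast; linarith) : k + 1 ≤ N)

theorem sq_mul_log_succ_le {k : ℕ} (hk : 3 ≤ k) :
    ((k + 1 : ℕ) : ℝ) ^ 2 * Real.log (k + 1 : ℕ) ≤
      (k : ℝ) ^ 2 * Real.log k + 7 * (k * Real.log k) := by
  have hk3 : (3 : ℝ) ≤ k := by exact_mod_cast hk
  have hlog := one_le_log_of_three_le hk3
  have h1 : Real.log (k + 1 : ℕ) ≤ Real.log k + 1 / k := by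
    have h2 : ((k + 1 : ℕ) : ℝ) = k * (1 + 1 / k) := by
      push_cast
      field_simp
    rw [h2, Real.log_mul (by positivity) (by positivity)]
    have := Real.log_le_sub_one_of_pos (show (0 : ℝ) < 1 + 1 / k by positivity)
    linarith
  have hinv : 1 / (k : ℝ) ≤ 1 := by rw [div_le_one (by linarith)]; linarith
  have h3 : ((k + 1 : ℕ) : ℝ) ^ 2 * (1 / k) = k + 2 + 1 / k := by
    push_cast
    field_simp
    ring
  have h4 : ((k + 1 : ℕ) : ℝ) ^ 2 * Real.log (k + 1 : ℕ) ≤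
      ((k + 1 : ℕ) : ℝ) ^ 2 * (Real.log k + 1 / k) := by gcongr
  rw [mul_add, h3] at h4
  push_cast at h4 ⊢
  nlinarith [mul_nonneg (by linarith : (0 : ℝ) ≤ k) (by linarith : 0 ≤ Real.log k - 1)]

theorem sq_mul_log_le_sum {k₀ : ℕ} (hk₀ : 3 ≤ k₀) (m : ℕ) :
    ((k₀ + m : ℕ) : ℝ) ^ 2 * Real.log (k₀ + m : ℕ) ≤ (k₀ : ℝ) ^ 2 * Real.log k₀ +
      ∑ j ∈ Finset.range m, 7 * (((k₀ + j : ℕ) : ℝ) * Real.log (k₀ + j : ℕ)) := by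
  induction m with
  | zero => simp
  | succ m ih =>
    rw [Finset.sum_range_succ]
    have := sq_mul_log_succ_le (k := k₀ + m) (by omega)
    rw [← add_assoc k₀ m 1]
    linarith

theorem ofReal_mul_logPlus_sq_le {k₀ : ℕ} (hk₀ : 3 ≤ k₀) {y : ℝ} (hy : 0 ≤ y) :
    ENNReal.ofReal (y * logPlus y ^ 2 * logPlus (logPlus y)) ≤
      ENNReal.ofReal ((k₀ : ℝ) ^ 2 * Real.log k₀) * ENNReal.ofReal y +
      ∑' j : ℕ, ENNReal.ofReal (7 * (((k₀ + j : ℕ) : ℝ) * Real.log (k₀ + j : ℕ))) *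
        {z | ENNReal.ofReal (Real.exp (k₀ + j : ℕ)) < z}.indicator (fun z => z)
          (ENNReal.ofReal y) := by
  have hlogn : ∀ n : ℕ, 0 ≤ Real.log n := Real.log_natCast_nonneg
  have key : ∀ n : ℕ, Real.log y ≤ n →
      y * logPlus y ^ 2 * logPlus (logPlus y) ≤ (n : ℝ) ^ 2 * Real.log n * y := by
    intro n hn
    obtain ⟨h2, h3⟩ := logPlus_logPlus_le hn
    have := logPlus_nonneg y
    have := logPlus_nonneg (logPlus y)
    calc y * logPlus y ^ 2 * logPlus (logPlus y) ≤ y * (n : ℝ) ^ 2 * Real.log n := by gcongr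
      _ = _ := by ring
  obtain ⟨m, hm, hm'⟩ : ∃ m : ℕ, Real.log y ≤ (k₀ + m : ℕ) ∧
      ∀ j < m, ((k₀ + j : ℕ) : ℝ) < Real.log y := by
    refine ⟨⌈Real.log y⌉₊ - k₀, ?_, fun j hj => Nat.lt_ceil.1 (by omega)⟩
    exact (Nat.le_ceil _).trans (by exact_mod_cast (by omega))
  have hmem : ∀ j < m, ENNReal.ofReal (Real.exp (k₀ + j : ℕ)) < ENNReal.ofReal y := by
    intro j hj
    have hlt := hm' j hj
    have hy0 : 0 < y := by
      refine lt_of_le_of_ne hy fun e => ?_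
      rw [← e, Real.log_zero] at hlt
      exact absurd hlt (not_lt.2 (Nat.cast_nonneg _))
    rw [ENNReal.ofReal_lt_ofReal_iff hy0]
    exact (Real.lt_log_iff_exp_lt hy0).1 hlt
  refine le_trans ?_ (add_le_add_right (ENNReal.sum_le_tsum (Finset.range m)) _)
  rw [Finset.sum_congr rfl fun j hj => by
    rw [Set.indicator_of_mem (show ENNReal.ofReal y ∈
      {z | ENNReal.ofReal (Real.exp (k₀ + j : ℕ)) < z} from hmem j (Finset.mem_range.1 hj))],
    ← Finset.sum_mul, ← add_mul, ← ENNReal.ofReal_sum_of_nonneg (fun j _ => by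
      have := hlogn (k₀ + j); positivity), ← ENNReal.ofReal_add (by have := hlogn k₀; positivity)
      (Finset.sum_nonneg fun j _ => by have := hlogn (k₀ + j); positivity),
    ← ENNReal.ofReal_mul' hy]
  refine ENNReal.ofReal_le_ofReal ((key _ hm).trans ?_)
  gcongr
  exact sq_mul_log_le_sum hk₀ m

theorem lintegral_tsum_indicator_maximalT (f : ℝ → ℝ) (μ : Measure ℝ) (r c : ℕ → ℝ≥0∞) :
    ∫⁻ θ, ∑' k : ℕ, {z | r k < z}.indicator (fun _ => c k) (maximalT f θ) ∂μ =
      ∑' k : ℕ, c k * μ {θ | r k < maximalT f θ} := by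
  have hset : ∀ k, MeasurableSet {z : ℝ≥0∞ | r k < z} := fun k => measurableSet_Ioi
  have hm : ∀ k, Measurable fun θ => {z | r k < z}.indicator (fun _ => c k) (maximalT f θ) :=
    fun k => (measurable_const.indicator (hset k)).comp (measurable_maximalT f)
  rw [lintegral_tsum fun k => (hm k).aemeasurable]
  exact tsum_congr fun k => lintegral_indicator_const (measurable_maximalT f (hset k)) _

theorem setLIntegral_enorm_lt_top_of_PhiE {f : ℝ → ℝ}
    (h : ∫⁻ θ in Set.Ico 0 (2 * π), PhiE (maximalT f θ) < ∞) :
    ∫⁻ y in Set.Ioo 0 (2 * π), ‖f y‖ₑ < ∞ := by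
  by_contra hcon
  rw [not_lt, top_le_iff] at hcon
  have hM : ∀ θ ∈ Set.Ioo 0 (2 * π), PhiE (maximalT f θ) = ∞ := by
    intro θ hθ
    have := le_maximalT f hθ.1 hθ.2 (by simp)
    rw [hcon, ENNReal.mul_top (ENNReal.inv_ne_zero.2 ENNReal.ofReal_ne_top), top_le_iff] at this
    rw [this, PhiE, if_pos rfl]
  rw [setLIntegral_congr Ioo_ae_eq_Ico.symm, setLIntegral_congr_fun measurableSet_Ioo hM,
    setLIntegral_const, Real.volume_Ioo, ENNReal.top_mul (by simp [Real.pi_pos])] at h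
  exact h.false

theorem setLIntegral_PhiE_maximalT_le {f : ℝ → ℝ} (hf : Measurable f)
    (hper : Function.Periodic f (2 * π)) :
    ∫⁻ θ in Set.Ico 0 (2 * π), PhiE (maximalT f θ) ≤
      ENNReal.ofReal (Real.exp 1) * 30 * ∫⁻ θ in Set.Ico 0 (2 * π), ENNReal.ofReal
        (130 * Real.exp 3 + 140 * (|f θ| * logPlus |f θ| ^ 2 * logPlus (logPlus |f θ|))) := by
  set μ := (volume : Measure ℝ).restrict (Set.Ico 0 (2 * π))
  set B : ℕ → ℝ := fun k => (k + 1) * Real.log (k + 1) + 1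
  have hset : ∀ k : ℕ, MeasurableSet {z : ℝ≥0∞ | ENNReal.ofReal (Real.exp k) / 2 < z} :=
    fun k => measurableSet_Ioi
  calc ∫⁻ θ, PhiE (maximalT f θ) ∂μ
      ≤ ∫⁻ θ, ∑' k : ℕ, {z | ENNReal.ofReal (Real.exp k) < z}.indicator
          (fun _ => ENNReal.ofReal (Real.exp (k + 1) * B k)) (maximalT f θ) ∂μ :=
        lintegral_mono fun θ => PhiE_le_tsum_indicator _
    _ = ∑' k : ℕ, ENNReal.ofReal (Real.exp (k + 1) * B k) *
          μ {θ | ENNReal.ofReal (Real.exp k) < maximalT f θ} := by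
        exact lintegral_tsum_indicator_maximalT f μ _ _
    _ ≤ ∑' k : ℕ, ENNReal.ofReal (Real.exp 1) * 30 * (ENNReal.ofReal (B k) *
          ∫⁻ y, {y | ENNReal.ofReal (Real.exp k) / 2 < ‖f y‖ₑ}.indicator
            (fun y => ‖f y‖ₑ) y ∂μ) := by
        refine ENNReal.tsum_le_tsum fun k => ?_
        have := mul_measure_lt_maximalT_le hper (ENNReal.ofReal_ne_top (r := Real.exp k))
        rw [add_comm, Real.exp_add, mul_right_comm, ENNReal.ofReal_mul' (Real.exp_pos _).le,
          ENNReal.ofReal_mul (Real.exp_pos _).le, mul_assoc]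
        refine (mul_le_mul_right this _).trans_eq ?_
        ring
    _ = ENNReal.ofReal (Real.exp 1) * 30 * ∫⁻ y, ∑' k : ℕ, ENNReal.ofReal (B k) *
          {z | ENNReal.ofReal (Real.exp k) / 2 < z}.indicator (fun z => z)
            (ENNReal.ofReal |f y|) ∂μ := by
        have hm : ∀ k : ℕ, Measurable fun y => {z | ENNReal.ofReal (Real.exp k) / 2 < z}.indicator
            (fun z => z) (ENNReal.ofReal |f y|) := fun k =>
          (measurable_id.indicator (hset k)).comp hf.abs.ennreal_ofReal
        rw [ENNReal.tsum_mul_left, lintegral_tsum fun k => ((hm k).const_mul _).aemeasurable]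
        congr 1
        refine tsum_congr fun k => ?_
        rw [lintegral_const_mul _ (hm k)]
        simp only [← Real.enorm_eq_ofReal_abs]
        rfl
    _ ≤ _ := by
        gcongr with y
        exact tsum_indicator_half_le (abs_nonneg _)

theorem setLIntegral_logPlus_sq_le {f : ℝ → ℝ} (hf : Measurable f) {k₀ : ℕ} (hk₀ : 3 ≤ k₀)
    (hmean : ∫⁻ y in Set.Ioo 0 (2 * π), ‖f y‖ₑ ≤
      ENNReal.ofReal (Real.exp k₀) * ENNReal.ofReal (2 * π)) :
    ∫⁻ θ in Set.Ioo 0 (2 * π), ENNReal.ofReal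
        (|f θ| * logPlus |f θ| ^ 2 * logPlus (logPlus |f θ|)) ≤
      ENNReal.ofReal ((k₀ : ℝ) ^ 2 * Real.log k₀) * (∫⁻ y in Set.Ioo 0 (2 * π), ‖f y‖ₑ) +
        14 * ∫⁻ θ in Set.Ioo 0 (2 * π), PhiE (maximalT f θ) := by
  set μ := (volume : Measure ℝ).restrict (Set.Ioo 0 (2 * π))
  set w : ℕ → ℝ := fun k => k * Real.log k
  have hw0 : ∀ k, 0 ≤ w k := fun k => mul_nonneg k.cast_nonneg (Real.log_natCast_nonneg k)
  have hset : ∀ k : ℕ, MeasurableSet {z : ℝ≥0∞ | ENNReal.ofReal (Real.exp k) < z} :=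
    fun k => measurableSet_Ioi
  have hm : ∀ k : ℕ, Measurable fun y => {z | ENNReal.ofReal (Real.exp k) < z}.indicator
      (fun z => z) (ENNReal.ofReal |f y|) := fun k =>
    (measurable_id.indicator (hset k)).comp hf.abs.ennreal_ofReal
  have htail : ∑' j : ℕ, ENNReal.ofReal (7 * w (k₀ + j)) *
      ∫⁻ y, {z | ENNReal.ofReal (Real.exp (k₀ + j : ℕ)) < z}.indicator (fun z => z)
        (ENNReal.ofReal |f y|) ∂μ ≤ 14 * ∫⁻ θ, PhiE (maximalT f θ) ∂μ := by
    calc ∑' j : ℕ, ENNReal.ofReal (7 * w (k₀ + j)) *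
        ∫⁻ y, {z | ENNReal.ofReal (Real.exp (k₀ + j : ℕ)) < z}.indicator (fun z => z)
          (ENNReal.ofReal |f y|) ∂μ
        ≤ ∑' j : ℕ, 7 * (ENNReal.ofReal (w (k₀ + j) * Real.exp (k₀ + j : ℕ)) *
            μ {θ | ENNReal.ofReal (Real.exp (k₀ + j : ℕ)) < maximalT f θ}) := by
          refine ENNReal.tsum_le_tsum fun j => ?_
          have hexp : Real.exp k₀ ≤ Real.exp (k₀ + j : ℕ) :=
            Real.exp_le_exp.2 (by exact_mod_cast Nat.le_add_right _ _)
          have := setLIntegral_le_mul_measure_lt_maximalT hf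
            (ENNReal.ofReal_ne_top (r := Real.exp (k₀ + j : ℕ))) (hmean.trans (by gcongr))
          simp only [← Real.enorm_eq_ofReal_abs]
          rw [ENNReal.ofReal_mul (by norm_num), ENNReal.ofReal_mul (hw0 _), ENNReal.ofReal_ofNat,
            mul_assoc, mul_assoc]
          gcongr
          exact this
      _ ≤ ∑' k : ℕ, 7 * (ENNReal.ofReal (w k * Real.exp k) *
            μ {θ | ENNReal.ofReal (Real.exp k) < maximalT f θ}) :=
          ENNReal.tsum_comp_le_tsum_of_injective (add_right_injective k₀) fun k : ℕ =>
            7 * (ENNReal.ofReal (w k * Real.exp k) *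
              μ {θ | ENNReal.ofReal (Real.exp k) < maximalT f θ})
      _ = 7 * ∫⁻ θ, ∑' k : ℕ, {z | ENNReal.ofReal (Real.exp k) < z}.indicator
            (fun _ => ENNReal.ofReal (w k * Real.exp k)) (maximalT f θ) ∂μ := by
          rw [ENNReal.tsum_mul_left, lintegral_tsum_indicator_maximalT]
      _ ≤ 7 * ∫⁻ θ, 2 * PhiE (maximalT f θ) ∂μ := by
          gcongr with θ
          exact tsum_indicator_le_PhiE _
      _ = 14 * ∫⁻ θ, PhiE (maximalT f θ) ∂μ := by
          rw [lintegral_const_mul' _ _ (by norm_num), ← mul_assoc]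
          norm_num
  calc ∫⁻ θ, ENNReal.ofReal (|f θ| * logPlus |f θ| ^ 2 * logPlus (logPlus |f θ|)) ∂μ
      ≤ ∫⁻ θ, ENNReal.ofReal ((k₀ : ℝ) ^ 2 * Real.log k₀) * ENNReal.ofReal |f θ| +
          ∑' j : ℕ, ENNReal.ofReal (7 * w (k₀ + j)) *
            {z | ENNReal.ofReal (Real.exp (k₀ + j : ℕ)) < z}.indicator (fun z => z)
              (ENNReal.ofReal |f θ|) ∂μ :=
        lintegral_mono fun θ => ofReal_mul_logPlus_sq_le hk₀ (abs_nonneg _)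
    _ = ENNReal.ofReal ((k₀ : ℝ) ^ 2 * Real.log k₀) * (∫⁻ y, ‖f y‖ₑ ∂μ) +
          ∑' j : ℕ, ENNReal.ofReal (7 * w (k₀ + j)) *
            ∫⁻ y, {z | ENNReal.ofReal (Real.exp (k₀ + j : ℕ)) < z}.indicator (fun z => z)
              (ENNReal.ofReal |f y|) ∂μ := by
        rw [lintegral_add_left (hf.abs.ennreal_ofReal.const_mul _),
          lintegral_const_mul _ hf.abs.ennreal_ofReal,
          lintegral_tsum fun j => ((hm _).const_mul _).aemeasurable]
        simp only [Real.enorm_eq_ofReal_abs]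
        congr 1
        exact tsum_congr fun j => lintegral_const_mul _ (hm _)
    _ ≤ _ := by gcongr

/-- `M(f)` belongs to the Orlicz space of `t log⁺t log⁺log⁺t` iff
`f ∈ L log² L log log L(𝕋)`. -/
theorem stmt8 (f : ℝ → ℝ) (hmeas : Measurable f) (hper : Function.Periodic f (2 * π)) :
    (∫⁻ θ in Set.Ico 0 (2 * π), PhiE (maximalT f θ)) < ⊤ ↔
      (∫⁻ θ in Set.Ico 0 (2 * π),
        ENNReal.ofReal (|f θ| * logPlus |f θ| ^ 2 * logPlus (logPlus |f θ|))) < ⊤ := by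
  constructor
  · intro h
    have hfin := setLIntegral_enorm_lt_top_of_PhiE h
    obtain ⟨n, hn⟩ := exists_nat_gt (∫⁻ y in Set.Ioo 0 (2 * π), ‖f y‖ₑ).toReal
    have hmean : ∫⁻ y in Set.Ioo 0 (2 * π), ‖f y‖ₑ ≤
        ENNReal.ofReal (Real.exp (n + 3 : ℕ)) * ENNReal.ofReal (2 * π) := by
      rw [← ENNReal.ofReal_mul (Real.exp_pos _).le, ← ENNReal.ofReal_toReal hfin.ne]
      refine ENNReal.ofReal_le_ofReal ?_
      have h1 := Real.add_one_le_exp ((n + 3 : ℕ) : ℝ)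
      push_cast at h1 ⊢
      nlinarith [Real.pi_gt_three, n.cast_nonneg (α := ℝ)]
    rw [setLIntegral_congr Ioo_ae_eq_Ico.symm] at h ⊢
    exact (setLIntegral_logPlus_sq_le hmeas (by omega) hmean).trans_lt <|
      ENNReal.add_lt_top.2 ⟨ENNReal.mul_lt_top ENNReal.ofReal_lt_top hfin,
        ENNReal.mul_lt_top (by simp) h⟩
  · intro h
    refine (setLIntegral_PhiE_maximalT_le hmeas hper).trans_lt ?_
    refine ENNReal.mul_lt_top (ENNReal.mul_lt_top ENNReal.ofReal_lt_top (by simp)) ?_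
    have hnonneg : ∀ θ, 0 ≤ |f θ| * logPlus |f θ| ^ 2 * logPlus (logPlus |f θ|) := fun θ =>
      mul_nonneg (by positivity) (logPlus_nonneg _)
    simp only [ENNReal.ofReal_add (by positivity : 0 ≤ 130 * Real.exp 3)
      (mul_nonneg (by norm_num : (0 : ℝ) ≤ 140) (hnonneg _)),
      ENNReal.ofReal_mul (by norm_num : (0 : ℝ) ≤ 140)]
    rw [lintegral_add_left measurable_const, lintegral_const_mul' _ _ ENNReal.ofReal_ne_top,
      setLIntegral_const, Real.volume_Ico]
    exact ENNReal.add_lt_top.2 ⟨ENNReal.mul_lt_top ENNReal.ofReal_lt_top ENNReal.ofReal_lt_top,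
      ENNReal.mul_lt_top ENNReal.ofReal_lt_top h⟩
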